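/- Let (W,S) be a finite Coxeter system with longest element w₀. In the group algebra ℚ[W], one has w₀ = Σ_{J ⊆ S} (-1)^{|J|} x_J, where x_J = Σ_{w ∈ X_J} w. -/

import Mathlib

open scoped Classical Pointwise

variable {B : Type*} [Fintype B]
variable {W : Type*} [Group W] [Fintype W]
variable {M : CoxeterMatrix B}

/-- The standard parabolic subgroup `W_J` of the Coxeter system `cs`,
generated by the simple reflections indexed by `J`. -/
def CoxParabolic (cs : CoxeterSystem M W) (J : Finset B) : Subgroup W :=
  Subgroup.closure (cs.simple '' ↑J)

/-- The set `X_J` of distinguished (minimal length) left coset representatives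
of `W_J` in `W`: the elements `w` with `l (w * s) > l w` for all simple `s` in `J`. -/
noncomputable def CoxX (cs : CoxeterSystem M W) (J : Finset B) : Finset W :=
  Finset.univ.filter fun w => ∀ j ∈ J, cs.length w < cs.length (w * cs.simple j)

/-- `D_J = Σ_{w ∈ X_J} (-1)^{l(w)}`. -/
noncomputable def CoxD (cs : CoxeterSystem M W) (J : Finset B) : ℤ :=
  ∑ w ∈ CoxX cs J, (-1) ^ cs.length w

namespace CoxeterSystem

section ReflectionCocycle

variable {B W : Type*} [Group W] {M : CoxeterMatrix B} (cs : CoxeterSystem M W)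

/-- The simple reflection `s i` acts on `W × ZMod 2` by conjugation on the first coordinate,
changing the second one exactly at `s i`. -/
noncomputable def signedConjSimple (i : B) : Equiv.Perm (W × ZMod 2) :=
  Function.Involutive.toPerm
    (fun p => (cs.simple i * p.1 * cs.simple i, p.2 + if p.1 = cs.simple i then 1 else 0)) <| by
    rintro ⟨t, ε⟩
    have h : cs.simple i * t * cs.simple i = cs.simple i ↔ t = cs.simple i := by
      rw [mul_assoc, mul_eq_left, mul_eq_one_iff_eq_inv, inv_simple]
    ext
    · simp [mul_assoc]
    · simp only [h, add_assoc, CharTwo.add_self_eq_zero, add_zero]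

theorem signedConjSimple_apply (i : B) (t : W) (ε : ZMod 2) :
    cs.signedConjSimple i (t, ε) =
      (cs.simple i * t * cs.simple i, ε + if t = cs.simple i then 1 else 0) := rfl

theorem pow_mul_simple_eq (i j : B) (n : ℕ) :
    (cs.simple j * cs.simple i) ^ n * cs.simple j =
      cs.simple j * (cs.simple i * cs.simple j) ^ n := by
  induction n with
  | zero => simp
  | succ n ih => rw [pow_succ', mul_assoc, ih, pow_succ']; simp only [mul_assoc]

theorem simple_mul_simple_pow_mul_pow (i j : B) (n : ℕ) :
    (cs.simple i * cs.simple j) ^ n * (cs.simple j * cs.simple i) ^ n = 1 := by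
  have h : cs.simple j * cs.simple i = (cs.simple i * cs.simple j)⁻¹ := by simp
  rw [h, inv_pow, mul_inv_cancel]

theorem signedConjSimple_mul_pow_apply (i j : B) (n : ℕ) (t : W) (ε : ZMod 2) :
    ((cs.signedConjSimple i * cs.signedConjSimple j) ^ n) (t, ε) =
      ((cs.simple i * cs.simple j) ^ n * t * (cs.simple j * cs.simple i) ^ n,
        ε + ∑ k ∈ Finset.range (2 * n),
          if t = (cs.simple j * cs.simple i) ^ k * cs.simple j then 1 else 0) := by
  induction n with
  | zero => simp
  | succ n ih =>
    have hconj : ∀ x : W, (cs.simple i * cs.simple j) ^ n * t * (cs.simple j * cs.simple i) ^ n = x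
        ↔ t = (cs.simple j * cs.simple i) ^ n * x * (cs.simple i * cs.simple j) ^ n := by
      intro x
      have hq := cs.simple_mul_simple_pow_mul_pow i j n
      rw [← eq_inv_iff_mul_eq_one] at hq
      rw [hq]
      constructor
      · rintro rfl
        group
      · rintro rfl
        group
    have h₁ : (cs.simple i * cs.simple j) ^ n * t * (cs.simple j * cs.simple i) ^ n = cs.simple j
        ↔ t = (cs.simple j * cs.simple i) ^ (2 * n) * cs.simple j := by
      rw [hconj, mul_assoc, ← pow_mul_simple_eq, ← mul_assoc, two_mul, pow_add]
    have h₂ : cs.simple j * ((cs.simple i * cs.simple j) ^ n * t *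
          (cs.simple j * cs.simple i) ^ n) * cs.simple j = cs.simple i
        ↔ t = (cs.simple j * cs.simple i) ^ (2 * n + 1) * cs.simple j := by
      rw [← eq_mul_inv_iff_mul_eq, ← eq_inv_mul_iff_mul_eq, hconj, inv_simple, mul_assoc,
        mul_assoc (cs.simple j), ← pow_succ', ← pow_mul_simple_eq, ← mul_assoc, ← pow_add,
        two_mul, add_assoc]
    rw [pow_succ', Equiv.Perm.mul_apply, ih, Equiv.Perm.mul_apply, signedConjSimple_apply,
      signedConjSimple_apply]
    ext
    · simp only [pow_succ' (cs.simple i * cs.simple j), pow_succ (cs.simple j * cs.simple i),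
        mul_assoc]
    · simp only [h₁, h₂, Nat.mul_succ, Finset.sum_range_succ, add_assoc]

theorem isLiftable_signedConjSimple : M.IsLiftable cs.signedConjSimple := by
  intro i j
  ext1 ⟨t, ε⟩
  rw [signedConjSimple_mul_pow_apply, two_mul, Finset.sum_range_add]
  simp only [pow_add, cs.simple_mul_simple_pow, cs.simple_mul_simple_pow', one_mul, mul_one,
    CharTwo.add_self_eq_zero, add_zero, Equiv.Perm.coe_one, id_eq]

/-- The action of `W` on `W × ZMod 2` extending `signedConjSimple`. -/
noncomputable def signedConj : W →* Equiv.Perm (W × ZMod 2) :=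
  cs.lift ⟨cs.signedConjSimple, cs.isLiftable_signedConjSimple⟩

/-- The reflection cocycle: at a reflection `t` it is `1` if `t` is a right inversion of `w`
and `0` otherwise. -/
noncomputable def reflectionCocycle (w t : W) : ZMod 2 := (cs.signedConj w (t, 0)).2

theorem signedConj_wordProd_apply (ω : List B) (t : W) (ε : ZMod 2) :
    cs.signedConj (cs.wordProd ω) (t, ε) =
      (cs.wordProd ω * t * (cs.wordProd ω)⁻¹, ε + ((cs.rightInvSeq ω).count t : ℕ)) := by
  induction ω with
  | nil => simp
  | cons i ω ih =>
    have h : cs.wordProd ω * t * (cs.wordProd ω)⁻¹ = cs.simple i ↔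
        (cs.wordProd ω)⁻¹ * cs.simple i * cs.wordProd ω = t := by
      constructor
      · intro h
        rw [← h]
        group
      · rintro rfl
        group
    rw [wordProd_cons, map_mul, Equiv.Perm.mul_apply, ih, signedConj, lift_apply_simple,
      signedConjSimple_apply]
    ext
    · simp [mul_assoc]
    · simp [rightInvSeq, List.count_cons, h, add_assoc]

theorem signedConj_apply (w t : W) (ε : ZMod 2) :
    cs.signedConj w (t, ε) = (w * t * w⁻¹, ε + cs.reflectionCocycle w t) := by
  obtain ⟨ω, -, rfl⟩ := cs.exists_isReduced w
  simp [reflectionCocycle, signedConj_wordProd_apply]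

theorem reflectionCocycle_mul (u w t : W) :
    cs.reflectionCocycle (u * w) t =
      cs.reflectionCocycle w t + cs.reflectionCocycle u (w * t * w⁻¹) := by
  rw [reflectionCocycle, map_mul, Equiv.Perm.mul_apply, signedConj_apply, signedConj_apply,
    zero_add]

theorem reflectionCocycle_one (t : W) : cs.reflectionCocycle 1 t = 0 := by
  simp [reflectionCocycle]

theorem reflectionCocycle_simple_self (i : B) :
    cs.reflectionCocycle (cs.simple i) (cs.simple i) = 1 := by
  rw [reflectionCocycle, signedConj, lift_apply_simple, signedConjSimple_apply]
  simp

variable {cs} in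
theorem IsReflection.reflectionCocycle_self {t : W} (ht : cs.IsReflection t) :
    cs.reflectionCocycle t t = 1 := by
  obtain ⟨u, i, rfl⟩ := ht
  have h := cs.reflectionCocycle_mul u u⁻¹ (u * cs.simple i * u⁻¹)
  have hu : u⁻¹ * (u * cs.simple i * u⁻¹) * u⁻¹⁻¹ = cs.simple i := by group
  rw [mul_inv_cancel, reflectionCocycle_one, hu] at h
  rw [reflectionCocycle_mul, hu, reflectionCocycle_mul, reflectionCocycle_simple_self,
    mul_inv_cancel_right, add_left_comm, ← h, add_zero]

theorem length_mul_lt_of_reflectionCocycle_ne_zero {w t : W}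
    (h : cs.reflectionCocycle w t ≠ 0) : cs.length (w * t) < cs.length w := by
  obtain ⟨ω, hω, rfl⟩ := cs.exists_isReduced w
  refine (cs.isRightInversion_of_mem_rightInvSeq hω ?_).2
  contrapose! h
  simp [reflectionCocycle, signedConj_wordProd_apply, List.count_eq_zero_of_not_mem h]

variable {cs} in
theorem IsReflection.reflectionCocycle_ne_zero_iff {t : W} (ht : cs.IsReflection t) (w : W) :
    cs.reflectionCocycle w t ≠ 0 ↔ cs.length (w * t) < cs.length w := by
  refine ⟨cs.length_mul_lt_of_reflectionCocycle_ne_zero, fun h h₀ => ?_⟩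
  have h₁ : cs.reflectionCocycle (w * t) t ≠ 0 := by
    rw [reflectionCocycle_mul, mul_inv_cancel_right, h₀, ht.reflectionCocycle_self]
    simp
  have h₂ := cs.length_mul_lt_of_reflectionCocycle_ne_zero h₁
  rw [mul_assoc, ht.mul_self, mul_one] at h₂
  omega

/-- If every simple reflection is a right descent of `w`, then every element is a suffix of a
reduced expression for `w`. -/
theorem length_mul_inv_add_length_of_forall_isRightDescent {w : W}
    (hw : ∀ i, cs.IsRightDescent w i) (v : W) :
    cs.length (w * v⁻¹) + cs.length v = cs.length w := by
  induction hn : cs.length v using Nat.strong_induction_on generalizing v with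
  | _ n ih =>
    subst hn
    by_cases hv : v = 1
    · simp [hv]
    obtain ⟨i, hi⟩ := cs.exists_rightDescent_of_ne_one hv
    obtain ⟨u, rfl⟩ : ∃ u, v = u * cs.simple i := ⟨v * cs.simple i, by simp⟩
    have hlen := cs.isRightDescent_iff.1 hi
    rw [mul_assoc, simple_mul_simple_self, mul_one] at hlen
    have hu := ih _ (by omega) u rfl
    have hui : cs.reflectionCocycle u (cs.simple i) = 0 := by
      by_contra h
      have := cs.length_mul_lt_of_reflectionCocycle_ne_zero h
      omega
    have hwi := ((cs.isReflection_simple i).reflectionCocycle_ne_zero_iff w).2 (hw i)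
    rw [← inv_mul_cancel_right w u, reflectionCocycle_mul, hui, zero_add] at hwi
    have hlt := cs.length_mul_lt_of_reflectionCocycle_ne_zero hwi
    have he : w * u⁻¹ * (u * cs.simple i * u⁻¹) = w * (u * cs.simple i)⁻¹ := by
      simp [mul_assoc]
    rw [he] at hlt
    have hle := cs.length_mul_le (w * (u * cs.simple i)⁻¹) (u * cs.simple i)
    rw [inv_mul_cancel_right] at hle
    omega

theorem forall_isRightDescent_iff_eq_longest {w₀ : W} (hw₀ : ∀ w, cs.length w ≤ cs.length w₀)
    (w : W) : (∀ i, cs.IsRightDescent w i) ↔ w = w₀ := by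
  constructor
  · intro h
    have h₁ := cs.length_mul_inv_add_length_of_forall_isRightDescent h w₀
    have h₂ := hw₀ w
    exact mul_inv_eq_one.1 (cs.length_eq_zero_iff.1 (by omega))
  · rintro rfl i
    exact lt_of_le_of_ne (hw₀ _) (cs.length_mul_simple_ne _ i)

end ReflectionCocycle

end CoxeterSystem

/-- Summing `(-1) ^ |J|` over all `J` with `w ∈ X_J` detects the longest element. -/
theorem sum_neg_one_pow_card_of_mem_CoxX (cs : CoxeterSystem M W) (w₀ : W)
    (hw₀ : ∀ w : W, cs.length w ≤ cs.length w₀) (w : W) :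
    (∑ J : Finset B, if w ∈ CoxX cs J then (-1 : ℚ) ^ J.card else 0) =
      if w = w₀ then 1 else 0 := by
  have hmem : ∀ J : Finset B, w ∈ CoxX cs J ↔
      J ∈ (Finset.univ.filter fun i => ¬ cs.IsRightDescent w i).powerset := by
    intro J
    have hlt (j : B) : cs.length w < cs.length (w * cs.simple j) ↔ ¬ cs.IsRightDescent w j := by
      rw [CoxeterSystem.IsRightDescent, not_lt]
      exact ⟨le_of_lt, fun h => lt_of_le_of_ne h (cs.length_mul_simple_ne w j).symm⟩
    simp [CoxX, hlt, Finset.subset_iff]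
  have hsum := congrArg (Int.cast : ℤ → ℚ) (Finset.sum_powerset_neg_one_pow_card
    (x := Finset.univ.filter fun i => ¬ cs.IsRightDescent w i))
  push_cast at hsum
  rw [← Finset.sum_filter]
  simp only [hmem, Finset.filter_mem_eq_inter, Finset.univ_inter]
  rw [hsum]
  simp [Finset.filter_eq_empty_iff, cs.forall_isRightDescent_iff_eq_longest hw₀]

/-- In the group algebra `ℚ[W]`, the longest element satisfies
`w₀ = Σ_{J ⊆ S} (-1)^{|J|} x_J`, where `x_J = Σ_{w ∈ X_J} w`. -/
theorem longest_eq_alternating_sum_x (cs : CoxeterSystem M W) (w₀ : W)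
    (hw₀ : ∀ w : W, cs.length w ≤ cs.length w₀) :
    (MonoidAlgebra.of ℚ W w₀ : MonoidAlgebra ℚ W) =
      ∑ J : Finset B, (-1 : ℚ) ^ J.card • ∑ w ∈ CoxX cs J, MonoidAlgebra.of ℚ W w := by
  have hX (J : Finset B) : ((-1 : ℚ) ^ J.card • ∑ w ∈ CoxX cs J, MonoidAlgebra.of ℚ W w) =
      ∑ w : W, (if w ∈ CoxX cs J then (-1 : ℚ) ^ J.card else 0) • MonoidAlgebra.of ℚ W w := by
    simp only [ite_smul, zero_smul, Finset.smul_sum, Finset.sum_ite_mem, Finset.univ_inter]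
  simp only [hX]
  rw [Finset.sum_comm]
  simp only [← Finset.sum_smul, sum_neg_one_pow_card_of_mem_CoxX cs w₀ hw₀]
  simp
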